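/- Let G be a finite group in which all maximal chains in G of every subgroup of prime order have the same length. If G is non-supersolvable and Z(G') ≠ 1, then F(G) = G'. -/

import Mathlib

/-- A maximal chain of `H` in the ambient group of length `r`: a chain
`H = c 0 < c 1 < ... < c r = ⊤` where each `c i` is a maximal subgroup of `c (i+1)`,
i.e. each step is a covering relation in the subgroup lattice. -/
def IsMaxChainOf {G : Type*} [Group G] (H : Subgroup G) (r : ℕ) (c : ℕ → Subgroup G) : Prop :=
  c 0 = H ∧ c r = ⊤ ∧ ∀ i < r, c i ⋖ c (i + 1)

/-- All maximal chains of `H` in the ambient group have the same length. -/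
def AllMaxChainsSameLength {G : Type*} [Group G] (H : Subgroup G) : Prop :=
  ∀ (r s : ℕ) (c d : ℕ → Subgroup G),
    IsMaxChainOf H r c → IsMaxChainOf H s d → r = s


/-- A group is supersolvable if it has a normal series (all terms normal in the whole
group) with cyclic factors.  The factor `s (i+1) / s i` being cyclic is encoded as:
some single element `g` together with `s i` generates `s (i+1)`. -/
def IsSupersolvable (G : Type*) [Group G] : Prop :=
  ∃ (n : ℕ) (s : ℕ → Subgroup G), s 0 = ⊥ ∧ s n = ⊤ ∧ (∀ i, (s i).Normal) ∧
    ∀ i < n, ∃ g : G, s i ⊔ Subgroup.zpowers g = s (i + 1)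


section Chains

/-- There is a chain of `n` covering relations from `a` up to `b`. -/
def CovChain {α : Type*} [Preorder α] : ℕ → α → α → Prop
  | 0, a, b => a = b
  | n + 1, a, b => ∃ c, a ⋖ c ∧ CovChain n c b

theorem CovChain.trans {α : Type*} [Preorder α] {m n : ℕ} {a b c : α}
    (h₁ : CovChain m a b) (h₂ : CovChain n b c) : CovChain (m + n) a c := by
  induction m generalizing a with
  | zero => cases h₁; simpa using h₂
  | succ m ih =>
    obtain ⟨d, had, hd⟩ := h₁
    rw [Nat.succ_add]
    exact ⟨d, had, ih hd⟩

theorem CovBy.covChain {α : Type*} [Preorder α] {a b : α} (h : a ⋖ b) : CovChain 1 a b :=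
  ⟨b, h, rfl⟩

theorem CovChain.le {α : Type*} [Preorder α] {n : ℕ} {a b : α} (h : CovChain n a b) : a ≤ b := by
  induction n generalizing a with
  | zero => exact le_of_eq h
  | succ n ih =>
    obtain ⟨d, had, hd⟩ := h
    exact (CovBy.le had).trans (ih hd)

theorem exists_covChain {α : Type*} [PartialOrder α] [Finite α] {a b : α} (h : a ≤ b) :
    ∃ n, CovChain n a b := by
  induction a using WellFoundedGT.induction with
  | _ a ih =>
    rcases h.eq_or_lt with rfl | hlt
    · exact ⟨0, rfl⟩
    · obtain ⟨c, hac, hcb⟩ := exists_covBy_le_of_lt hlt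
      obtain ⟨n, hn⟩ := ih c hac.lt hcb
      exact ⟨n + 1, c, hac, hn⟩

theorem CovChain.exists_seq {α : Type*} [Preorder α] {n : ℕ} {a b : α} (h : CovChain n a b) :
    ∃ c : ℕ → α, c 0 = a ∧ c n = b ∧ ∀ i < n, c i ⋖ c (i + 1) := by
  induction n generalizing a with
  | zero => exact ⟨fun _ => a, rfl, h, by simp⟩
  | succ n ih =>
    obtain ⟨d, had, hd⟩ := h
    obtain ⟨c, h0, hn, hc⟩ := ih hd
    refine ⟨fun i => Nat.casesOn i a c, rfl, hn, ?_⟩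
    rintro (_ | i) hi
    · simpa [h0] using had
    · exact hc i (by omega)

theorem CovChain.map {α β : Type*} [Preorder α] [Preorder β] {n : ℕ} {a b : α} (f : α → β)
    (hf : ∀ x y, x ⋖ y → f x ⋖ f y) (h : CovChain n a b) : CovChain n (f a) (f b) := by
  induction n generalizing a with
  | zero => exact congrArg f h
  | succ n ih =>
    obtain ⟨d, had, hd⟩ := h
    exact ⟨f d, hf _ _ had, ih hd⟩

end Chains

section IntervalChains

variable {G : Type*} [Group G]

/-- Any two saturated chains from `H` to the whole group have the same length. -/
def EqualChains (H : Subgroup G) : Prop :=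
  ∀ r s : ℕ, CovChain r H ⊤ → CovChain s H ⊤ → r = s

theorem EqualChains.mono [Finite G] {H K : Subgroup G} (h : EqualChains H) (hHK : H ≤ K) :
    EqualChains K := by
  intro r s hr hs
  obtain ⟨n, hn⟩ := exists_covChain hHK
  have := h _ _ (hn.trans hr) (hn.trans hs)
  omega

theorem Subgroup.map_subtype_covBy {K : Subgroup G} {A B : Subgroup K} (h : A ⋖ B) :
    A.map K.subtype ⋖ B.map K.subtype := by
  refine ⟨(Subgroup.map_lt_map_iff_of_injective K.subtype_injective).2 h.lt, fun C hAC hCB => ?_⟩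
  have hCK : C ≤ K := hCB.le.trans (Subgroup.map_subtype_le B)
  rw [← Subgroup.map_subgroupOf_eq_of_le hCK,
    Subgroup.map_lt_map_iff_of_injective K.subtype_injective] at hAC hCB
  exact h.2 hAC hCB

theorem Subgroup.comap_mk'_covBy {N : Subgroup G} [N.Normal] {A B : Subgroup (G ⧸ N)}
    (h : A ⋖ B) : A.comap (QuotientGroup.mk' N) ⋖ B.comap (QuotientGroup.mk' N) := by
  have hs := QuotientGroup.mk'_surjective N
  refine ⟨(Subgroup.comap_lt_comap_of_surjective hs).2 h.lt, fun C hAC hCB => ?_⟩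
  have hNC : (QuotientGroup.mk' N).ker ≤ C :=
    (Subgroup.ker_le_comap _ A).trans hAC.le
  rw [← Subgroup.comap_map_eq_self hNC, Subgroup.comap_lt_comap_of_surjective hs] at hAC hCB
  exact h.2 hAC hCB

theorem EqualChains.subgroup [Finite G] (h : EqualChains (⊥ : Subgroup G)) (K : Subgroup G) :
    EqualChains (⊥ : Subgroup K) := by
  intro r s hr hs
  obtain ⟨n, hn⟩ := exists_covChain (le_top : K ≤ ⊤)
  have key : ∀ r, CovChain r (⊥ : Subgroup K) ⊤ → CovChain (r + n) (⊥ : Subgroup G) ⊤ := by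
    intro r hr
    have := hr.map (Subgroup.map K.subtype) fun _ _ => Subgroup.map_subtype_covBy
    rw [Subgroup.map_bot, ← MonoidHom.range_eq_map, Subgroup.range_subtype] at this
    exact this.trans hn
  have := h _ _ (key r hr) (key s hs)
  omega

theorem EqualChains.quotient {N : Subgroup G} [N.Normal] (h : EqualChains N) :
    EqualChains (⊥ : Subgroup (G ⧸ N)) := by
  have key : ∀ r, CovChain r (⊥ : Subgroup (G ⧸ N)) ⊤ → CovChain r N ⊤ := by
    intro r hr
    have := hr.map (Subgroup.comap (QuotientGroup.mk' N)) fun _ _ => Subgroup.comap_mk'_covBy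
    rwa [MonoidHom.comap_bot, QuotientGroup.ker_mk', Subgroup.comap_top] at this
  exact fun r s hr hs => h r s (key r hr) (key s hs)

end IntervalChains

section PrimeCovers

variable {G : Type*} [Group G]

theorem Subgroup.relIndex_ne_zero_of_finite [Finite G] (H K : Subgroup G) : H.relIndex K ≠ 0 :=
  Subgroup.index_ne_zero_of_finite

/-- Every covering relation between subgroups containing `H₀` has prime index. -/
def PrimeCovers (H₀ : Subgroup G) : Prop :=
  ∀ H K : Subgroup G, H₀ ≤ H → H ⋖ K → (H.relIndex K).Prime

/-- There is a chain of subgroups from `H` to `K` all of whose steps have prime index. -/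
def PrimeChain : Subgroup G → Subgroup G → Prop :=
  Relation.ReflTransGen fun H K => H ≤ K ∧ (H.relIndex K).Prime

theorem PrimeChain.le {H K : Subgroup G} (h : PrimeChain H K) : H ≤ K := by
  induction h with
  | refl => exact le_rfl
  | tail _ h ih => exact ih.trans h.1

theorem Subgroup.covBy_of_relIndex_prime {H K : Subgroup G} (hle : H ≤ K)
    (hp : (H.relIndex K).Prime) : H ⋖ K := by
  refine ⟨lt_of_le_not_ge hle fun h => hp.ne_one (Subgroup.relIndex_eq_one.2 h), ?_⟩
  intro C hHC hCK
  rw [← Subgroup.relIndex_mul_relIndex H C K hHC.le hCK.le, Nat.prime_mul_iff] at hp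
  rcases hp with ⟨-, h⟩ | ⟨-, h⟩
  · exact hCK.not_ge (Subgroup.relIndex_eq_one.1 h)
  · exact hHC.not_ge (Subgroup.relIndex_eq_one.1 h)

open ArithmeticFunction in
theorem PrimeChain.covChain [Finite G] {H K : Subgroup G} (h : PrimeChain H K) :
    CovChain (cardFactors (H.relIndex K)) H K := by
  induction h with
  | refl => simp [CovChain]
  | @tail A B hA h ih =>
    rw [← Subgroup.relIndex_mul_relIndex H A B (PrimeChain.le hA) h.1,
      cardFactors_mul (Subgroup.relIndex_ne_zero_of_finite _ _) (Subgroup.relIndex_ne_zero_of_finite _ _),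
      cardFactors_eq_one_iff_prime.2 h.2]
    exact ih.trans (Subgroup.covBy_of_relIndex_prime h.1 h.2).covChain

open ArithmeticFunction in
theorem CovChain.length_le [Finite G] {n : ℕ} {H K : Subgroup G} (h : CovChain n H K) :
    n ≤ cardFactors (H.relIndex K) := by
  induction n generalizing H with
  | zero => simp
  | succ n ih =>
    obtain ⟨L, hHL, hL⟩ := h
    rw [← Subgroup.relIndex_mul_relIndex H L K hHL.le hL.le,
      cardFactors_mul (Subgroup.relIndex_ne_zero_of_finite _ _) (Subgroup.relIndex_ne_zero_of_finite _ _)]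
    have h1 : cardFactors (H.relIndex L) ≠ 0 := by
      rw [Ne, cardFactors_eq_zero_iff_eq_zero_or_one]
      rintro (h | h)
      · exact (Subgroup.relIndex_ne_zero_of_finite _ _) h
      · exact hHL.lt.not_ge (Subgroup.relIndex_eq_one.1 h)
    have := ih hL
    omega

open ArithmeticFunction in
theorem EqualChains.primeCovers [Finite G] {H₀ : Subgroup G} (h : EqualChains H₀)
    (hc : PrimeChain H₀ ⊤) : PrimeCovers H₀ := by
  intro H K h0 hHK
  obtain ⟨a, ha⟩ := exists_covChain h0
  obtain ⟨b, hb⟩ := exists_covChain (le_top : K ≤ ⊤)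
  have hlen := h _ _ hc.covChain ((ha.trans hHK.covChain).trans hb)
  rw [← Subgroup.relIndex_mul_relIndex H₀ H ⊤ h0 le_top,
    ← Subgroup.relIndex_mul_relIndex H K ⊤ hHK.le le_top,
    cardFactors_mul (Subgroup.relIndex_ne_zero_of_finite _ _)
      (mul_ne_zero (Subgroup.relIndex_ne_zero_of_finite _ _) (Subgroup.relIndex_ne_zero_of_finite _ _)),
    cardFactors_mul (Subgroup.relIndex_ne_zero_of_finite _ _) (Subgroup.relIndex_ne_zero_of_finite _ _)] at hlen
  have h1 := ha.length_le
  have h2 := hb.length_le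
  have h3 := hHK.covChain.length_le
  exact cardFactors_eq_one_iff_prime.1 (by omega)

theorem PrimeCovers.mono {H K : Subgroup G} (h : PrimeCovers H) (hHK : H ≤ K) : PrimeCovers K :=
  fun A B hA hAB => h A B (hHK.trans hA) hAB

theorem PrimeCovers.quotient {N : Subgroup G} [N.Normal] (h : PrimeCovers N) :
    PrimeCovers (⊥ : Subgroup (G ⧸ N)) := by
  intro A B _ hAB
  have := h _ _ (by simpa using Subgroup.ker_le_comap (QuotientGroup.mk' N) A)
    (Subgroup.comap_mk'_covBy hAB)
  rwa [Subgroup.relIndex_comap,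
    Subgroup.map_comap_eq_self_of_surjective (QuotientGroup.mk'_surjective N)] at this

theorem Subgroup.index_prime_of_isCoatom [Finite G] {L : Subgroup G} [L.Normal]
    (hL : IsCoatom L) : L.index.Prime := by
  have hs := QuotientGroup.mk'_surjective L
  have hne : L.index ≠ 1 := fun h => hL.1 (Subgroup.index_eq_one.1 h)
  have hp := Nat.minFac_prime hne
  have : Fact L.index.minFac.Prime := ⟨hp⟩
  obtain ⟨x, hx⟩ := exists_prime_orderOf_dvd_card' (G := G ⧸ L) L.index.minFac
    (Nat.minFac_dvd L.index)
  have hle : L ≤ (Subgroup.zpowers x).comap (QuotientGroup.mk' L) := by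
    simpa using Subgroup.ker_le_comap (QuotientGroup.mk' L) (Subgroup.zpowers x)
  have hlt : L < (Subgroup.zpowers x).comap (QuotientGroup.mk' L) := by
    refine lt_of_le_of_ne hle fun h => ?_
    have hbot : Subgroup.zpowers x = ⊥ := by
      rw [← Subgroup.map_comap_eq_self_of_surjective hs (Subgroup.zpowers x), ← h]
      simp
    rw [Subgroup.zpowers_eq_bot] at hbot
    rw [hbot, orderOf_one] at hx
    exact hp.ne_one hx.symm
  have htop : Subgroup.zpowers x = ⊤ := by
    rw [← Subgroup.map_comap_eq_self_of_surjective hs (Subgroup.zpowers x), hL.2 _ hlt,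
      Subgroup.map_top_of_surjective _ hs]
  have hcard : Nat.card (G ⧸ L) = L.index.minFac := by
    rw [← hx, ← Nat.card_zpowers, htop, Subgroup.card_top]
  rw [Subgroup.index, hcard]
  exact hp

/-- In a nontrivial finite solvable group there is a normal subgroup of prime index. -/
theorem exists_normal_index_prime [Finite G] [Group.IsSolvable G] [Nontrivial G] :
    ∃ L : Subgroup G, L.Normal ∧ L.index.Prime := by
  have hlt : commutator G ≠ ⊤ := (Group.IsSolvable.commutator_lt_top_of_nontrivial G).ne
  obtain ⟨L, hL, hle⟩ := (eq_top_or_exists_le_coatom (commutator G)).resolve_left hlt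
  have hn : L.Normal := Subgroup.Normal.of_commutator_le G hle
  exact ⟨L, hn, Subgroup.index_prime_of_isCoatom hL⟩

theorem PrimeChain.of_le_normalizer [Finite G] [Group.IsSolvable G] {H K : Subgroup G}
    (hHK : H ≤ K) (hK : K ≤ Subgroup.normalizer H) : PrimeChain H K := by
  induction K using WellFoundedLT.induction with
  | _ K ih =>
    rcases hHK.eq_or_lt with rfl | hlt
    · exact Relation.ReflTransGen.refl
    have hn : (H.subgroupOf K).Normal := (Subgroup.normal_subgroupOf_iff_le_normalizer hHK).2 hK
    have hnt : Nontrivial (K ⧸ H.subgroupOf K) := by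
      rw [← not_subsingleton_iff_nontrivial]
      intro h
      exact hlt.not_ge (Subgroup.subgroupOf_eq_top.1
        (QuotientGroup.subgroup_eq_top_of_subsingleton _ h))
    obtain ⟨L, -, hL⟩ := exists_normal_index_prime (G := K ⧸ H.subgroupOf K)
    set M := L.comap (QuotientGroup.mk' (H.subgroupOf K)) with hM
    have hMi : M.index = L.index :=
      L.index_comap_of_surjective (QuotientGroup.mk'_surjective _)
    have hHM : H.subgroupOf K ≤ M := by
      simpa using Subgroup.ker_le_comap (QuotientGroup.mk' (H.subgroupOf K)) L
    have hle : M.map K.subtype ≤ K := Subgroup.map_subtype_le M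
    have hidx : (M.map K.subtype).relIndex K = L.index := by
      rw [Subgroup.relIndex, ← hMi, Subgroup.subgroupOf,
        Subgroup.comap_map_eq_self_of_injective K.subtype_injective]
    have hHM' : H ≤ M.map K.subtype := by
      rw [← Subgroup.map_subgroupOf_eq_of_le hHK]
      exact Subgroup.map_mono hHM
    have hprime : ((M.map K.subtype).relIndex K).Prime := hidx ▸ hL
    exact (ih _ (Subgroup.covBy_of_relIndex_prime hle hprime).lt hHM' (hle.trans hK)).tail
      ⟨hle, hprime⟩

theorem IsPGroup.exists_primeChain_sylow [Finite G] {p : ℕ} [Fact p.Prime] {X : Subgroup G}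
    (hX : IsPGroup p X) : ∃ P : Sylow p G, PrimeChain X P := by
  induction X using WellFoundedGT.induction with
  | _ X ih =>
    obtain ⟨n, hn⟩ := IsPGroup.iff_card.1 hX
    by_cases hdvd : p ^ (n + 1) ∣ Nat.card G
    · obtain ⟨K, hK, hXK⟩ := Sylow.exists_subgroup_card_pow_succ hdvd hn
      have hp : (X.relIndex K).Prime := by
        have h := Subgroup.relIndex_mul_relIndex ⊥ X K bot_le hXK
        rw [Subgroup.relIndex_bot_left, Subgroup.relIndex_bot_left, hK, hn, pow_succ] at h
        rw [Nat.eq_of_mul_eq_mul_left (pow_pos (Fact.out : p.Prime).pos n) h]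
        exact Fact.out
      obtain ⟨P, hP⟩ := ih K (Subgroup.covBy_of_relIndex_prime hXK hp).lt (IsPGroup.of_card hK)
      exact ⟨P, hP.head ⟨hXK, hp⟩⟩
    · obtain ⟨P, hP⟩ := hX.exists_le_sylow
      obtain ⟨m, hm⟩ := IsPGroup.iff_card.1 P.2
      have hmn : m ≤ n := by
        by_contra! h
        exact hdvd ((pow_dvd_pow p h).trans (hm ▸ Subgroup.card_subgroup_dvd_card (P : Subgroup G)))
      have : X = P := by
        refine Subgroup.eq_of_le_of_card_ge hP ?_
        rw [hn, hm]
        exact Nat.pow_le_pow_right (Fact.out : p.Prime).pos hmn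
      exact ⟨P, this ▸ Relation.ReflTransGen.refl⟩

end PrimeCovers

section PrimeIndex

variable {G : Type*} [Group G]

theorem Subgroup.relIndex_sup_of_inf_eq_bot [Finite G] {K X : Subgroup G} [X.Normal]
    (h : K ⊓ X = ⊥) : K.relIndex (K ⊔ X) = Nat.card X := by
  have h1 := Subgroup.relIndex_mul_relIndex ⊥ X (K ⊔ X) bot_le le_sup_right
  have h2 := Subgroup.relIndex_mul_relIndex ⊥ K (K ⊔ X) bot_le le_sup_left
  have h3 : X.relIndex K = Nat.card K := by
    rw [← Subgroup.inf_relIndex_right, inf_comm, h, Subgroup.relIndex_bot_left]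
  rw [Subgroup.relIndex_sup_right, h3, Subgroup.relIndex_bot_left] at h1
  rw [← h1, Subgroup.relIndex_bot_left, mul_comm (Nat.card X)] at h2
  exact Nat.eq_of_mul_eq_mul_left Nat.card_pos h2

theorem Subgroup.sup_inf_eq_of_le_sup {K L Z : Subgroup G} [Z.Normal] (hKL : K ≤ L)
    (hL : L ≤ K ⊔ Z) : K ⊔ (L ⊓ Z) = L := by
  refine le_antisymm (sup_le hKL inf_le_left) fun x hx => ?_
  obtain ⟨k, hk, z, hz, rfl⟩ := Subgroup.mem_sup_of_normal_right.1 (hL hx)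
  refine mul_mem (Subgroup.mem_sup_left hk) (Subgroup.mem_sup_right ⟨?_, hz⟩)
  exact (Subgroup.mul_mem_cancel_left L (hKL hk)).1 hx

theorem PrimeCovers.sylow_normal [Finite G] (h : PrimeCovers (⊥ : Subgroup G)) {q : ℕ}
    [Fact q.Prime] (hq : ∀ r : ℕ, r.Prime → r ∣ Nat.card G → r ≤ q) (Q : Sylow q G) :
    (Q : Subgroup G).Normal := by
  rw [← Subgroup.normalizer_eq_top_iff]
  refine (eq_top_or_exists_le_coatom _).resolve_right ?_
  rintro ⟨M, hM, hle⟩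
  have hprime := h M ⊤ bot_le hM.covBy_top
  rw [Subgroup.relIndex_top_right] at hprime
  have hrq := hq _ hprime M.index_dvd_card
  have hQM : (Q : Subgroup G) ≤ M := Subgroup.le_normalizer.trans hle
  have h1 : (Subgroup.normalizer ((Q : Subgroup G) : Set G)).index ≡ 1 [MOD q] := by
    have := card_sylow_modEq_one q G
    rwa [Sylow.card_eq_index_normalizer Q] at this
  have h2 : (Subgroup.normalizer (((Q : Subgroup G).subgroupOf M : Subgroup M) : Set M)).index
      ≡ 1 [MOD q] := by
    have := card_sylow_modEq_one q M
    rwa [Sylow.card_eq_index_normalizer (Q.subtype hQM)] at this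
  rw [← Subgroup.subgroupOf_normalizer_eq hQM] at h2
  have h3 := Subgroup.relIndex_mul_index hle
  rw [← h3] at h1
  have h4 : 1 ≡ M.index [MOD q] := by
    have := (h2.mul_right M.index).symm.trans h1
    rw [one_mul] at this
    exact this.symm
  have := Nat.le_of_dvd (by have := hprime.two_le; omega)
    ((Nat.modEq_iff_dvd' hprime.one_lt.le).1 h4)
  have := hprime.two_le
  omega

theorem Subgroup.inf_normal_of_sup_eq_top {K L Q : Subgroup G} [Q.Normal] (hKL : K ≤ L)
    (h : Q ⊔ K = ⊤) : (L ⊓ (Subgroup.center Q).map Q.subtype).Normal := by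
  set Z := (Subgroup.center Q).map Q.subtype
  have hZ : Z.Normal := inferInstance
  have hK : ∀ g ∈ K, ∀ x ∈ L ⊓ Z, g * x * g⁻¹ ∈ L ⊓ Z := fun g hg x hx =>
    ⟨L.mul_mem (L.mul_mem (hKL hg) hx.1) (L.inv_mem (hKL hg)), hZ.conj_mem x hx.2 g⟩
  refine ⟨fun x hx g => ?_⟩
  obtain ⟨a, ha, k, hk, rfl⟩ := Subgroup.mem_sup_of_normal_left.1 (h ▸ Subgroup.mem_top g)
  have hk' := hK k hk x hx
  obtain ⟨-, y, hy, hyx⟩ := id hk'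
  have hcomm := congrArg Subtype.val (Subgroup.mem_center_iff.1 hy ⟨a, ha⟩)
  simp only [Subgroup.subtype_apply] at hyx
  simp only [Subgroup.coe_mul, hyx] at hcomm
  have : a * k * x * (a * k)⁻¹ = k * x * k⁻¹ := by
    rw [eq_comm, ← mul_inv_eq_iff_eq_mul.2 hcomm]
    group
  rwa [this]

/-- A nontrivial group with all covering indices prime has a normal subgroup whose order is the
largest prime divisor of the order of the group. -/
theorem PrimeCovers.exists_normal_card_prime [Finite G] [Nontrivial G]
    (h : PrimeCovers (⊥ : Subgroup G)) : ∃ X : Subgroup G, X.Normal ∧ (Nat.card X).Prime ∧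
      ∀ r : ℕ, r.Prime → r ∣ Nat.card G → r ≤ Nat.card X := by
  obtain ⟨q, hqmem, hqmax⟩ := (Nat.card G).primeFactors.exists_max_image id
    (Nat.nonempty_primeFactors.2 Finite.one_lt_card)
  have hqp := Nat.prime_of_mem_primeFactors hqmem
  have hqd := Nat.dvd_of_mem_primeFactors hqmem
  have hmax : ∀ r : ℕ, r.Prime → r ∣ Nat.card G → r ≤ q := fun r hr hrd =>
    hqmax r (Nat.mem_primeFactors.2 ⟨hr, hrd, Nat.card_pos.ne'⟩)
  have : Fact q.Prime := ⟨hqp⟩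
  let Q : Sylow q G := default
  have hQn : (Q : Subgroup G).Normal := h.sylow_normal hmax Q
  obtain ⟨K, hK⟩ := Subgroup.exists_right_complement'_of_coprime Q.card_coprime_index
  have hQnt : Nontrivial Q :=
    Finite.one_lt_card_iff_nontrivial.1 (lt_of_lt_of_le hqp.one_lt
      (Nat.le_of_dvd Nat.card_pos (Q.dvd_card_of_dvd_card hqd)))
  set Z := (Subgroup.center Q).map (Q : Subgroup G).subtype with hZ
  have hZn : Z.Normal := inferInstance
  have hZQ : Z ≤ Q := Subgroup.map_subtype_le _
  have hZbot : Z ≠ ⊥ := by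
    have := Q.2.center_nontrivial
    rw [hZ, Ne, (Subgroup.map_eq_bot_iff_of_injective _ (Subgroup.subtype_injective _))]
    exact (Subgroup.nontrivial_iff_ne_bot _).1 this
  have hKZ : K ⊓ Z = ⊥ :=
    le_bot_iff.1 ((inf_le_inf_left K hZQ).trans (by rw [inf_comm]; exact hK.disjoint.le_bot))
  have hlt : K < K ⊔ Z := by
    refine lt_of_le_of_ne le_sup_left fun he => hZbot ?_
    rw [← hKZ, eq_comm, inf_eq_right, he]
    exact le_sup_right
  obtain ⟨L, hKL, hL⟩ := exists_covBy_le_of_lt hlt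
  have hX : (L ⊓ Z).Normal := Subgroup.inf_normal_of_sup_eq_top hKL.le hK.sup_eq_top
  have hcard : K.relIndex L = Nat.card (L ⊓ Z : Subgroup G) := by
    rw [← Subgroup.relIndex_sup_of_inf_eq_bot (K := K)
      (le_bot_iff.1 ((inf_le_inf_left K inf_le_right).trans hKZ.le)),
      Subgroup.sup_inf_eq_of_le_sup hKL.le hL]
  have hprime := h K L bot_le hKL
  rw [hcard] at hprime
  refine ⟨L ⊓ Z, hX, hprime, ?_⟩
  obtain ⟨n, hn⟩ := IsPGroup.iff_card.1 Q.2
  have hdvd : Nat.card (L ⊓ Z : Subgroup G) ∣ q ^ n :=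
    hn ▸ Subgroup.card_dvd_of_le (inf_le_right.trans hZQ)
  rwa [(Nat.prime_dvd_prime_iff_eq hprime hqp).1 (hprime.dvd_of_dvd_pow hdvd)]

end PrimeIndex

section PrimeIndexConsequences

variable {G : Type*} [Group G]

theorem IsSupersolvable.of_quotient {X : Subgroup G} [X.Normal]
    (hX : ∃ g : G, Subgroup.zpowers g = X) (h : IsSupersolvable (G ⧸ X)) : IsSupersolvable G := by
  obtain ⟨x, hx⟩ := hX
  obtain ⟨n, s, h0, hn, hs, hstep⟩ := h
  set π := QuotientGroup.mk' X with hπ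
  have hsurj := QuotientGroup.mk'_surjective X
  refine ⟨n + 1, fun i => Nat.casesOn i ⊥ fun j => (s j).comap π, rfl, ?_, ?_, ?_⟩
  · simp [hn]
  · rintro (_ | i)
    · exact inferInstanceAs (⊥ : Subgroup G).Normal
    · have := hs i
      exact inferInstanceAs ((s i).comap π).Normal
  · rintro (_ | i) hi
    · exact ⟨x, by simp [h0, hx, hπ]⟩
    · obtain ⟨g', hg'⟩ := hstep i (by omega)
      obtain ⟨g, rfl⟩ := hsurj g'
      refine ⟨g, ?_⟩
      have hker : π.ker ≤ (s i).comap π ⊔ Subgroup.zpowers g :=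
        (Subgroup.ker_le_comap π (s i)).trans le_sup_left
      change (s i).comap π ⊔ Subgroup.zpowers g = (s (i + 1)).comap π
      rw [← Subgroup.comap_map_eq_self hker, Subgroup.map_sup,
        Subgroup.map_comap_eq_self_of_surjective hsurj, MonoidHom.map_zpowers, hg']

theorem Subgroup.exists_zpowers_eq_of_card_prime {X : Subgroup G} (hX : (Nat.card X).Prime) :
    ∃ g : G, Subgroup.zpowers g = X := by
  have : Fact (Nat.card X).Prime := ⟨hX⟩
  exact (Subgroup.isCyclic_iff_exists_zpowers_eq_top X).1 (isCyclic_of_prime_card rfl)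

theorem Subgroup.card_quotient_lt [Finite G] {X : Subgroup G} (hX : X ≠ ⊥) :
    Nat.card (G ⧸ X) < Nat.card G := by
  rw [← X.card_mul_index]
  exact lt_mul_of_one_lt_left Nat.card_pos (X.one_lt_card_iff_ne_bot.2 hX)

theorem Subgroup.ne_bot_of_card_prime {X : Subgroup G} (hX : (Nat.card X).Prime) : X ≠ ⊥ :=
  fun h => hX.ne_one (Subgroup.card_eq_one.2 h)

theorem PrimeCovers.isSupersolvable [Finite G] (h : PrimeCovers (⊥ : Subgroup G)) :
    IsSupersolvable G := by
  induction hn : Nat.card G using Nat.strong_induction_on generalizing G with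
  | _ n ih =>
    rcases subsingleton_or_nontrivial G with hG | hG
    · exact ⟨0, fun _ => ⊥, rfl, Subsingleton.elim _ _, fun _ => inferInstance, by simp⟩
    · obtain ⟨X, hXn, hX, -⟩ := h.exists_normal_card_prime
      exact .of_quotient (Subgroup.exists_zpowers_eq_of_card_prime hX)
        (ih _ (hn ▸ Subgroup.card_quotient_lt (Subgroup.ne_bot_of_card_prime hX))
          (h.mono bot_le).quotient rfl)

theorem isNilpotent_commutator_of_quotient {X : Subgroup G} [X.Normal]
    (hX : X ≤ Subgroup.centralizer (_root_.commutator G))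
    (h : Group.IsNilpotent (commutator (G ⧸ X))) : Group.IsNilpotent (commutator G) := by
  have hmap : ∀ x : commutator G,
      ((QuotientGroup.mk' X).comp (commutator G).subtype) x ∈ commutator (G ⧸ X) := by
    intro x
    have : (commutator G).map (QuotientGroup.mk' X) ≤ commutator (G ⧸ X) := by
      rw [commutator_def, commutator_def, Subgroup.map_commutator]
      exact Subgroup.commutator_mono le_top le_top
    exact this (Subgroup.mem_map_of_mem _ x.2)
  refine Subgroup.isNilpotent_of_ker_le_center
    (((QuotientGroup.mk' X).comp (commutator G).subtype).codRestrict _ hmap) ?_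
  intro x hx
  rw [MonoidHom.ker_codRestrict, MonoidHom.mem_ker] at hx
  have hxX : (x : G) ∈ X := (QuotientGroup.eq_one_iff _).1 hx
  rw [Subgroup.mem_center_iff]
  exact fun y => Subtype.ext (Subgroup.mem_centralizer_iff.1 (hX hxX) y y.2)

theorem Subgroup.le_centralizer_commutator_of_card_prime {X : Subgroup G} [X.Normal]
    (hX : (Nat.card X).Prime) : X ≤ Subgroup.centralizer (_root_.commutator G) := by
  have : Fact (Nat.card X).Prime := ⟨hX⟩
  have : IsCyclic X := isCyclic_of_prime_card rfl
  rw [Subgroup.le_centralizer_iff]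
  intro g hg
  have hker := Abelianization.commutator_subset_ker
    (((IsCyclic.mulAutMulEquiv X).toMonoidHom.comp (MulAut.conjNormal (H := X)))) hg
  have h1 : MulAut.conjNormal (H := X) g = 1 :=
    (IsCyclic.mulAutMulEquiv X).injective (by simpa using hker)
  rw [Subgroup.mem_centralizer_iff]
  intro x hx
  have h2 := congrArg Subtype.val (DFunLike.congr_fun h1 ⟨x, hx⟩)
  simp only [MulAut.conjNormal_apply, MulAut.one_apply] at h2
  rw [eq_comm, ← mul_inv_eq_iff_eq_mul, h2]

theorem PrimeCovers.isNilpotent_commutator [Finite G] (h : PrimeCovers (⊥ : Subgroup G)) :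
    Group.IsNilpotent (commutator G) := by
  induction hn : Nat.card G using Nat.strong_induction_on generalizing G with
  | _ n ih =>
    rcases subsingleton_or_nontrivial G with hG | hG
    · infer_instance
    · obtain ⟨X, hXn, hX, -⟩ := h.exists_normal_card_prime
      exact isNilpotent_commutator_of_quotient (Subgroup.le_centralizer_commutator_of_card_prime hX)
        (ih _ (hn ▸ Subgroup.card_quotient_lt (Subgroup.ne_bot_of_card_prime hX))
          (h.mono bot_le).quotient rfl)

/-- A group with all covering indices prime has a normal complement to its Sylow subgroups for the
smallest prime divisor of the order. -/
theorem PrimeCovers.exists_normal_complement [Finite G] (h : PrimeCovers (⊥ : Subgroup G))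
    {p : ℕ} (hp : p.Prime) (hmin : ∀ r : ℕ, r.Prime → r ∣ Nat.card G → p ≤ r) :
    ∃ K : Subgroup G, K.Normal ∧ ¬ p ∣ Nat.card K ∧ ∃ n, K.index = p ^ n := by
  induction hn : Nat.card G using Nat.strong_induction_on generalizing G with
  | _ n ih =>
    rcases subsingleton_or_nontrivial G with hG | hG
    · exact ⟨⊥, inferInstance, by simpa using hp.ne_one, 0, by simp [Subsingleton.elim ⊥ ⊤]⟩
    obtain ⟨X, hXn, hX, hXmax⟩ := h.exists_normal_card_prime
    by_cases hpX : p = Nat.card X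
    · refine ⟨⊥, inferInstance, by simpa using hp.ne_one, (Nat.card G).primeFactorsList.length, ?_⟩
      rw [Subgroup.index_bot]
      refine Nat.eq_prime_pow_of_unique_prime_dvd Nat.card_pos.ne' fun {r} hr hrd => ?_
      exact le_antisymm (hpX ▸ hXmax r hr hrd) (hmin r hr hrd)
    · have hcard : Nat.card (G ⧸ X) * Nat.card X = Nat.card G := by
        rw [mul_comm]; exact X.card_mul_index
      obtain ⟨K, hKn, hpK, m, hm⟩ := ih _
        (hn ▸ Subgroup.card_quotient_lt (Subgroup.ne_bot_of_card_prime hX))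
        (h.mono bot_le : PrimeCovers X).quotient
        (fun r hr hrd => hmin r hr (hrd.trans (hcard ▸ dvd_mul_right _ _))) rfl
      have hidx := K.index_comap_of_surjective (QuotientGroup.mk'_surjective X)
      refine ⟨K.comap (QuotientGroup.mk' X), inferInstance, ?_, m, hidx.trans hm⟩
      have hc : Nat.card (K.comap (QuotientGroup.mk' X)) = Nat.card K * Nat.card X := by
        have h1 := (K.comap (QuotientGroup.mk' X)).card_mul_index
        rw [hidx, ← hcard, ← K.card_mul_index, mul_right_comm] at h1
        exact Nat.eq_of_mul_eq_mul_right (hm ▸ pow_pos hp.pos m) h1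
      rw [hc, hp.dvd_mul]
      rintro (hd | hd)
      · exact hpK hd
      · exact hpX ((Nat.prime_dvd_prime_iff_eq hp hX).1 hd)

end PrimeIndexConsequences

section Fusion

open scoped commutatorElement

variable {G : Type*} [Group G]

/-- Normalizers of nontrivial `p`-subgroups factor as a centralizer times any Sylow subgroup. -/
def LocallyPNilpotent (p : ℕ) (G : Type*) [Group G] : Prop :=
  ∀ D : Subgroup G, IsPGroup p D → D ≠ ⊥ →
    ∀ (T : Sylow p (Subgroup.normalizer (D : Set G))) (g : Subgroup.normalizer (D : Set G)),
      ∃ c : Subgroup.normalizer (D : Set G), (c : G) ∈ Subgroup.centralizer (D : Set G) ∧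
        ∃ t ∈ T, c * t = g

theorem IsPGroup.exists_mem_centralizer_mul_sylow [Finite G] {p : ℕ} [Fact p.Prime]
    {D : Subgroup G} [D.Normal] (hD : IsPGroup p D) {K : Subgroup G} [K.Normal]
    (hK : ¬ p ∣ Nat.card K) (hi : ∃ n, K.index = p ^ n) (T : Sylow p G) (g : G) :
    ∃ c ∈ Subgroup.centralizer (D : Set G), ∃ t ∈ T, c * t = g := by
  obtain ⟨n, hn⟩ := hi
  obtain ⟨m, hm⟩ := IsPGroup.iff_card.1 hD
  have hp : p.Prime := Fact.out
  have hdisj : Disjoint K D := Subgroup.disjoint_of_coprime_natCard <| by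
    rw [hm]
    exact ((hp.coprime_iff_not_dvd.2 hK).symm).pow_right m
  have hKC : K ≤ Subgroup.centralizer (D : Set G) := fun k hk =>
    Subgroup.mem_centralizer_iff.2 fun d hd =>
      (Subgroup.commute_of_normal_of_disjoint K D inferInstance inferInstance hdisj k d hk hd).symm
  have htop : K ⊔ (T : Subgroup G) = ⊤ := by
    rw [← Subgroup.index_eq_one]
    have h1 : (K ⊔ (T : Subgroup G)).index ∣ p ^ n :=
      hn ▸ Subgroup.index_dvd_of_le le_sup_left
    have h2 : (K ⊔ (T : Subgroup G)).index ∣ (T : Subgroup G).index :=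
      Subgroup.index_dvd_of_le le_sup_right
    have h3 : (p ^ n).Coprime (T : Subgroup G).index :=
      ((hp.coprime_iff_not_dvd.2 T.not_dvd_index)).pow_left n
    exact Nat.eq_one_of_dvd_coprimes h3 h1 h2
  obtain ⟨k, hk, t, ht, rfl⟩ := Subgroup.mem_sup_of_normal_left.1 (htop ▸ Subgroup.mem_top g)
  exact ⟨k, hKC hk, t, ht, rfl⟩

theorem IsPGroup.lt_normalizer_inf [Finite G] {p : ℕ} [Fact p.Prime] {P D : Subgroup G}
    (hP : IsPGroup p P) (h : D < P) : D < Subgroup.normalizer (D : Set G) ⊓ P := by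
  have := hP.isNilpotent
  refine lt_of_le_of_ne (le_inf Subgroup.le_normalizer h.le) fun he => ?_
  have hlt : D.subgroupOf P < ⊤ :=
    lt_top_iff_ne_top.2 fun ht => h.not_ge (Subgroup.subgroupOf_eq_top.1 ht)
  have := Group.normalizerCondition_of_isNilpotent _ hlt
  rw [← Subgroup.subgroupOf_normalizer_eq h.le,
    ← Subgroup.inf_subgroupOf_right (Subgroup.normalizer (D : Set G)) P, ← he] at this
  exact this.false

theorem LocallyPNilpotent.exists_mem_centralizer_smul [Finite G] {p : ℕ} [Fact p.Prime]
    (h : LocallyPNilpotent p G) (D : Subgroup G) (P R : Sylow p G) (hP : D ≤ P) (hR : D ≤ R) :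
    ∃ c ∈ Subgroup.centralizer (D : Set G), c • P = R := by
  induction D using WellFoundedGT.induction generalizing P R with
  | _ D ih =>
    by_cases hD : D = ⊥
    · obtain ⟨c, hc⟩ := MulAction.exists_smul_eq G P R
      exact ⟨c, by simp [hD, Subgroup.mem_centralizer_iff], hc⟩
    rcases hP.eq_or_lt with hDP | hDP
    · exact ⟨1, one_mem _, by rw [one_smul]; exact (Sylow.ext (P.3 R.2 (hDP ▸ hR))).symm⟩
    rcases hR.eq_or_lt with hDR | hDR
    · exact ⟨1, one_mem _, by rw [one_smul]; exact Sylow.ext (R.3 P.2 (hDR ▸ hP))⟩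
    set N := Subgroup.normalizer (D : Set G)
    have hA := P.2.lt_normalizer_inf hDP
    have hB := R.2.lt_normalizer_inf hDR
    obtain ⟨T₁, hT₁⟩ := ((P.2.to_le (inf_le_right : N ⊓ P ≤ P)).comap_subtype
      (K := N)).exists_le_sylow
    obtain ⟨T₂, hT₂⟩ := ((R.2.to_le (inf_le_right : N ⊓ R ≤ R)).comap_subtype
      (K := N)).exists_le_sylow
    obtain ⟨g, hg⟩ := MulAction.exists_smul_eq N T₁ T₂
    obtain ⟨c, hc, t, ht, rfl⟩ := h D (P.2.to_le hP) hD T₁ g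
    rw [mul_smul, T₁.smul_eq_iff_mem_normalizer.2 (Subgroup.le_normalizer ht)] at hg
    obtain ⟨P₁, hP₁⟩ := (T₁.2.map N.subtype).exists_le_sylow
    have hAP₁ : N ⊓ P ≤ P₁ := fun x hx => hP₁ ⟨⟨x, hx.1⟩, hT₁ hx, rfl⟩
    have hBP₁ : N ⊓ R ≤ ((c : G) • P₁ : Sylow p G) := by
      intro x hx
      have hx' : (⟨x, hx.1⟩ : N) ∈ T₂ := hT₂ hx
      rw [← hg] at hx'
      obtain ⟨y, hy, hyx⟩ := hx'
      refine ⟨y, hP₁ ⟨y, hy, rfl⟩, congrArg Subtype.val hyx⟩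
    obtain ⟨a, ha, ha'⟩ := ih _ hA P P₁ inf_le_right hAP₁
    obtain ⟨b, hb, hb'⟩ := ih _ hB ((c : G) • P₁) R hBP₁ inf_le_right
    refine ⟨b * (c * a), mul_mem (Subgroup.centralizer_le hB.le hb)
      (mul_mem hc (Subgroup.centralizer_le hA.le ha)), ?_⟩
    rw [mul_smul, mul_smul, ha', hb']

theorem LocallyPNilpotent.exists_conj_eq [Finite G] {p : ℕ} [Fact p.Prime]
    (h : LocallyPNilpotent p G) (P : Sylow p G) {x u : G} (hx : x ∈ P) (hu : u * x * u⁻¹ ∈ P) :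
    ∃ v ∈ P, v * x * v⁻¹ = u * x * u⁻¹ := by
  by_cases hP : (P : Subgroup G) = ⊥
  · have : x = 1 := Subgroup.mem_bot.1 (hP ▸ hx)
    exact ⟨1, one_mem _, by simp [this]⟩
  have hxu : x ∈ (u⁻¹ • P : Sylow p G) := ⟨_, hu, by simp [mul_assoc]⟩
  obtain ⟨c, hc, hcP⟩ := h.exists_mem_centralizer_smul (Subgroup.zpowers x) P (u⁻¹ • P)
    (Subgroup.zpowers_le.2 hx) (Subgroup.zpowers_le.2 hxu)
  have huc : u * c ∈ Subgroup.normalizer ((P : Subgroup G) : Set G) := by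
    refine P.smul_eq_iff_mem_normalizer.1 ?_
    rw [mul_smul, hcP, smul_inv_smul]
  obtain ⟨k, hk, v, hv, hkv⟩ := h P P.2 hP (P.subtype Subgroup.le_normalizer) ⟨u * c, huc⟩
  have hkv' : (k : G) * v = u * c := congrArg Subtype.val hkv
  have hvP : (v : G) ∈ P := hv
  refine ⟨v, hvP, ?_⟩
  have hcx : x * c = c * x := Subgroup.mem_centralizer_iff.1 hc x (Subgroup.mem_zpowers x)
  have hkx := Subgroup.mem_centralizer_iff.1 hk (v * x * (v : G)⁻¹)
    ((P : Subgroup G).mul_mem (mul_mem hvP hx) (inv_mem hvP))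
  have hu' : u = k * v * c⁻¹ := by rw [hkv', mul_inv_cancel_right]
  have h1 : c⁻¹ * x * c = x := by rw [mul_assoc, hcx, inv_mul_cancel_left]
  calc (v : G) * x * (v : G)⁻¹ = k * (v * x * (v : G)⁻¹) * (k : G)⁻¹ := by
        exact (mul_inv_eq_iff_eq_mul.2 hkx.symm).symm
    _ = k * (v * (c⁻¹ * x * c) * (v : G)⁻¹) * (k : G)⁻¹ := by rw [h1]
    _ = u * x * u⁻¹ := by rw [hu']; group

theorem LocallyPNilpotent.focalSubgroup_le [Finite G] {p : ℕ} [Fact p.Prime]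
    (h : LocallyPNilpotent p G) (P : Sylow p G) :
    (P : Subgroup G).focalSubgroup ≤ ⁅(P : Subgroup G), (P : Subgroup G)⁆ := by
  rw [Subgroup.focalSubgroup_def, Subgroup.closure_le]
  rintro g ⟨hg, x, hx, u, rfl⟩
  have hu : u * x⁻¹ * u⁻¹ ∈ P := by
    rw [commutatorElement_def, mul_assoc, mul_assoc] at hg
    have := ((P : Subgroup G).mul_mem_cancel_left hx).1 hg
    rwa [← mul_assoc] at this
  obtain ⟨v, hv, hvx⟩ := h.exists_conj_eq P (inv_mem hx) hu
  have : ⁅x, u⁆ = ⁅x, v⁆ := by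
    simp only [commutatorElement_def, mul_assoc] at hvx ⊢
    rw [hvx]
  rw [this]
  exact Subgroup.commutator_mem_commutator hx hv

end Fusion

section Solvability

variable {G : Type*} [Group G]

theorem PrimeCovers.of_equalChains [Finite G] [Group.IsSolvable G]
    (h : EqualChains (⊥ : Subgroup G)) : PrimeCovers (⊥ : Subgroup G) :=
  h.primeCovers (.of_le_normalizer bot_le (Subgroup.normalizer_eq_top_iff.2 inferInstance).ge)

theorem isSolvable_of_normal {N : Subgroup G} [N.Normal] (h₁ : Group.IsSolvable N)
    (h₂ : Group.IsSolvable (G ⧸ N)) : Group.IsSolvable G :=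
  Group.isSolvable_of_ker_le_range N.subtype (QuotientGroup.mk' N) (by simp)

theorem IsPGroup.isSolvable_of_normal_of_forall_normal [Finite G] {p : ℕ} [Fact p.Prime]
    (hsimple : ∀ N : Subgroup G, N.Normal → N = ⊥ ∨ N = ⊤) {D : Subgroup G} (hDn : D.Normal)
    (hD : IsPGroup p D) (hbot : D ≠ ⊥) : Group.IsSolvable G := by
  have htop := (hsimple D hDn).resolve_left hbot
  have : IsPGroup p G := by
    rw [htop] at hD
    exact hD.of_equiv Subgroup.topEquiv
  have := this.isNilpotent
  infer_instance

theorem LocallyPNilpotent.of_forall_primeCovers [Finite G] {p : ℕ} [Fact p.Prime]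
    (hmin : ∀ r : ℕ, r.Prime → r ∣ Nat.card G → p ≤ r)
    (h : ∀ D : Subgroup G, IsPGroup p D → D ≠ ⊥ →
      PrimeCovers (⊥ : Subgroup (Subgroup.normalizer (D : Set G)))) :
    LocallyPNilpotent p G := by
  intro D hD hbot T g
  obtain ⟨K, hKn, hK, hi⟩ := (h D hD hbot).exists_normal_complement (Fact.out : p.Prime)
    fun r hr hrd => hmin r hr (hrd.trans (Subgroup.card_subgroup_dvd_card _))
  have : (D.comap (Subgroup.normalizer (D : Set G)).subtype).Normal :=
    Subgroup.normal_in_normalizer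
  obtain ⟨c, hc, t, ht, hct⟩ := (hD.comap_subtype
    (K := Subgroup.normalizer (D : Set G))).exists_mem_centralizer_mul_sylow hK hi T g
  refine ⟨c, Subgroup.mem_centralizer_iff.2 fun d hd => ?_, t, ht, hct⟩
  exact congrArg Subtype.val
    (Subgroup.mem_centralizer_iff.1 hc ⟨d, Subgroup.le_normalizer hd⟩ hd)

theorem isSolvable_of_commutator_eq_bot (h : commutator G = ⊥) : Group.IsSolvable G :=
  ⟨⟨1, by rw [derivedSeries_one, h]⟩⟩

theorem LocallyPNilpotent.commutator_ne_top [Finite G] {p : ℕ} [Fact p.Prime]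
    (h : LocallyPNilpotent p G) (hp : p ∣ Nat.card G) : commutator G ≠ ⊤ := by
  intro htop
  let P : Sylow p G := default
  have hP := Subgroup.commutator_inf_eq_focalSubgroup P
  rw [htop, top_inf_eq] at hP
  have hle := h.focalSubgroup_le P
  have hPtop : commutator P = ⊤ := by
    refine top_le_iff.1 fun x _ => ?_
    have hx := hle (hP ▸ x.2 : (x : G) ∈ (P : Subgroup G).focalSubgroup)
    rw [← Subgroup.map_subtype_commutator] at hx
    obtain ⟨y, hy, hyx⟩ := hx
    rwa [← Subtype.ext hyx]
  have hnt : Nontrivial P := Finite.one_lt_card_iff_nontrivial.1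
    (lt_of_lt_of_le (Fact.out : p.Prime).one_lt
      (Nat.le_of_dvd Nat.card_pos (P.dvd_card_of_dvd_card hp)))
  have := P.2.isNilpotent
  exact (Group.IsSolvable.commutator_lt_top_of_nontrivial P).ne hPtop

/-- A finite group all of whose maximal chains of subgroups have the same length is solvable. -/
theorem EqualChains.isSolvable [Finite G] (h : EqualChains (⊥ : Subgroup G)) :
    Group.IsSolvable G := by
  induction hn : Nat.card G using Nat.strong_induction_on generalizing G with
  | _ n ih =>
    rcases subsingleton_or_nontrivial G with hG | hG
    · infer_instance
    have hsub : ∀ K : Subgroup G, K ≠ ⊤ → Group.IsSolvable K := fun K hK =>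
      ih _ (hn ▸ lt_of_le_of_ne K.card_le_card_group fun he => hK (K.eq_top_of_card_eq he))
        (h.subgroup K) rfl
    by_cases hN : ∃ N : Subgroup G, N.Normal ∧ N ≠ ⊥ ∧ N ≠ ⊤
    · obtain ⟨N, hNn, hbot, htop⟩ := hN
      exact isSolvable_of_normal (hsub N htop)
        (ih _ (hn ▸ Subgroup.card_quotient_lt hbot) (h.mono bot_le).quotient rfl)
    by_contra hns
    have hsimple : ∀ N : Subgroup G, N.Normal → N = ⊥ ∨ N = ⊤ := fun N hNn => by
      by_contra! hc
      exact hN ⟨N, hNn, hc⟩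
    have hp := Nat.minFac_prime (Finite.one_lt_card (α := G)).ne'
    have : Fact (Nat.card G).minFac.Prime := ⟨hp⟩
    have hloc : LocallyPNilpotent (Nat.card G).minFac G := by
      refine .of_forall_primeCovers (fun r hr hrd => Nat.minFac_le_of_dvd hr.two_le hrd) ?_
      intro D hD hbot
      have := hsub (Subgroup.normalizer (D : Set G)) fun he => hns <|
        hD.isSolvable_of_normal_of_forall_normal hsimple (Subgroup.normalizer_eq_top_iff.1 he) hbot
      exact .of_equalChains (h.subgroup _)
    rcases hsimple (commutator G) inferInstance with hc | hc
    · exact hns (isSolvable_of_commutator_eq_bot hc)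
    · exact hloc.commutator_ne_top (Nat.minFac_dvd _) hc

end Solvability

section NormalSubgroups

variable {G : Type*} [Group G]

theorem Subgroup.exists_le_card_eq_prime [Finite G] {Z : Subgroup G} {p : ℕ} (hp : p.Prime)
    (h : p ∣ Nat.card Z) : ∃ H ≤ Z, Nat.card H = p := by
  have : Fact p.Prime := ⟨hp⟩
  obtain ⟨x, hx⟩ := exists_prime_orderOf_dvd_card' (G := Z) p h
  refine ⟨Subgroup.zpowers (x : G), Subgroup.zpowers_le.2 x.2, ?_⟩
  rw [Nat.card_zpowers, Subgroup.orderOf_coe, hx]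

theorem Subgroup.exists_le_card_prime [Finite G] {Z : Subgroup G} (h : Z ≠ ⊥) :
    ∃ H ≤ Z, (Nat.card H).Prime := by
  have hp := Nat.minFac_prime (Z.one_lt_card_iff_ne_bot.2 h).ne'
  obtain ⟨H, hH, hc⟩ := Subgroup.exists_le_card_eq_prime hp (Nat.minFac_dvd _)
  exact ⟨H, hH, hc ▸ hp⟩

theorem EqualChains.isSolvable_of_normal [Finite G]
    (hE : ∀ H : Subgroup G, (Nat.card H).Prime → EqualChains H) {Z : Subgroup G} [Z.Normal]
    (hZ : Group.IsSolvable Z) (hbot : Z ≠ ⊥) : Group.IsSolvable G := by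
  obtain ⟨H, hHZ, hH⟩ := Subgroup.exists_le_card_prime hbot
  exact _root_.isSolvable_of_normal hZ ((hE H hH).mono hHZ).quotient.isSolvable

theorem PrimeChain.le_top_of_normal [Finite G] [Group.IsSolvable G] (R : Subgroup G) [R.Normal] :
    PrimeChain R ⊤ :=
  .of_le_normalizer le_top (Subgroup.normalizer_eq_top_iff.2 inferInstance).ge

theorem PrimeCovers.of_normal [Finite G] [Group.IsSolvable G]
    (hE : ∀ H : Subgroup G, (Nat.card H).Prime → EqualChains H) {R : Subgroup G} [R.Normal]
    (hbot : R ≠ ⊥) : PrimeCovers R := by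
  have hc : PrimeChain ⊥ R :=
    .of_le_normalizer bot_le
      (le_top.trans (Subgroup.normalizer_eq_top_iff.2 inferInstance).ge)
  rcases hc.cases_head with h | ⟨X, ⟨-, hX⟩, hXR⟩
  · exact absurd h.symm hbot
  rw [Subgroup.relIndex_bot_left] at hX
  exact ((hE X hX).primeCovers
    (Relation.ReflTransGen.trans hXR (PrimeChain.le_top_of_normal R))).mono (PrimeChain.le hXR)

theorem PrimeCovers.isSupersolvable_of_card_prime [Finite G] {X : Subgroup G} [X.Normal]
    (h : PrimeCovers X) (hX : (Nat.card X).Prime) : IsSupersolvable G :=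
  .of_quotient (Subgroup.exists_zpowers_eq_of_card_prime hX) h.quotient.isSupersolvable

theorem PrimeCovers.exists_normal_card_prime_le [Finite G] {R N : Subgroup G} (hR : R.Normal)
    [N.Normal] (h : PrimeCovers R) (hRN : R ⊓ N = ⊥) (hN : N ≠ ⊥) :
    ∃ X ≤ N, X.Normal ∧ (Nat.card X).Prime := by
  induction R using WellFoundedGT.induction with
  | _ R ih =>
    have hnt : Nontrivial (G ⧸ R) := by
      rw [← not_subsingleton_iff_nontrivial]
      intro hs
      rw [QuotientGroup.subgroup_eq_top_of_subsingleton R hs, top_inf_eq] at hRN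
      exact hN hRN
    obtain ⟨L, hLn, hL, -⟩ := h.quotient.exists_normal_card_prime
    set Y := L.comap (QuotientGroup.mk' R)
    have hYn : Y.Normal := inferInstance
    have hRY : R ≤ Y := by
      simpa using Subgroup.ker_le_comap (QuotientGroup.mk' R) L
    have hidx : R.relIndex Y = Nat.card L := by
      have := Subgroup.relIndex_comap (⊥ : Subgroup (G ⧸ R)) (QuotientGroup.mk' R) Y
      rwa [MonoidHom.comap_bot, QuotientGroup.ker_mk',
        Subgroup.map_comap_eq_self_of_surjective (QuotientGroup.mk'_surjective R),
        Subgroup.relIndex_bot_left] at this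
    by_cases hYN : Y ⊓ N = ⊥
    · exact ih Y (Subgroup.covBy_of_relIndex_prime hRY (hidx ▸ hL)).lt hYn (h.mono hRY) hYN
    · refine ⟨Y ⊓ N, inf_le_right, inferInstance, ?_⟩
      have h1 := Subgroup.relIndex_sup_of_inf_eq_bot (K := R) (X := Y ⊓ N)
        (le_bot_iff.1 ((inf_le_inf_left R inf_le_right).trans hRN.le))
      have h2 : Nat.card (Y ⊓ N : Subgroup G) ∣ Nat.card L := by
        rw [← h1, ← hidx]
        exact ⟨_, (Subgroup.relIndex_mul_relIndex _ _ _ le_sup_left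
          (sup_le hRY inf_le_left)).symm⟩
      rcases (Nat.dvd_prime hL).1 h2 with h3 | h3
      · exact absurd (Subgroup.card_eq_one.1 h3) hYN
      · exact h3 ▸ hL

/-- A nilpotent normal subgroup is a `p`-group if nontrivial normal subgroups always meet. -/
theorem exists_isPGroup_of_forall_normal_inf_ne_bot [Finite G]
    (hinf : ∀ N R : Subgroup G, N.Normal → R.Normal → N ≠ ⊥ → R ≠ ⊥ → N ⊓ R ≠ ⊥)
    (F : Subgroup G) [F.Normal] [Group.IsNilpotent F] (hF : F ≠ ⊥) :
    ∃ p : ℕ, p.Prime ∧ IsPGroup p F := by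
  have hp := Nat.minFac_prime (F.one_lt_card_iff_ne_bot.2 hF).ne'
  have key : ∀ q : ℕ, q.Prime → q ∣ Nat.card F →
      ∃ S : Subgroup G, S.Normal ∧ S ≠ ⊥ ∧ IsPGroup q S := by
    intro q hq hqd
    have : Fact q.Prime := ⟨hq⟩
    let S : Sylow q F := default
    have hSn : (S : Subgroup F).Normal :=
      S.normal_of_normalizerCondition Group.normalizerCondition_of_isNilpotent
    have hSc := Sylow.characteristic_of_normal S hSn
    refine ⟨(S : Subgroup F).map F.subtype, inferInstance, ?_, S.2.map _⟩
    rw [Ne, Subgroup.map_eq_bot_iff_of_injective _ F.subtype_injective]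
    exact S.ne_bot_of_dvd_card hqd
  refine ⟨_, hp, ?_⟩
  refine IsPGroup.of_card (n := (Nat.card F).primeFactorsList.length) <|
    Nat.eq_prime_pow_of_unique_prime_dvd Nat.card_pos.ne' fun {r} hr hrd => ?_
  by_contra hne
  obtain ⟨S, hS, hS1, hS2⟩ := key _ hp (Nat.minFac_dvd _)
  obtain ⟨T, hT, hT1, hT2⟩ := key r hr hrd
  have : Fact r.Prime := ⟨hr⟩
  have : Fact (Nat.card F).minFac.Prime := ⟨hp⟩
  exact hinf S T hS hT hS1 hT1 (IsPGroup.disjoint_of_ne _ r (Ne.symm hne) S T hS2 hT2).eq_bot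

end NormalSubgroups

section Main

variable {G : Type*} [Group G]

theorem Subgroup.exists_sylow_not_le_centralizer [Finite G]
    (hinf : ∀ N R : Subgroup G, N.Normal → R.Normal → N ≠ ⊥ → R ≠ ⊥ → N ⊓ R ≠ ⊥)
    (hprime : ∀ X : Subgroup G, X.Normal → ¬ (Nat.card X).Prime) {p : ℕ} [Fact p.Prime]
    {P : Sylow p G} (hP : (P : Subgroup G).Normal) {N : Subgroup G} (hNn : N.Normal) (hN : N ≠ ⊥)
    (hmin : ∀ M : Subgroup G, M.Normal → M ≤ N → M = ⊥ ∨ M = N) (hNP : N ≤ P) :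
    ∃ r : ℕ, r.Prime ∧ r ≠ p ∧
      ∃ T : Sylow r G, ¬ (T : Subgroup G) ≤ Subgroup.centralizer (N : Set G) := by
  by_contra! hc
  have hPnt : Nontrivial P :=
    (Subgroup.nontrivial_iff_ne_bot _).2 fun h => hN (le_bot_iff.1 (h ▸ hNP))
  set Z := (Subgroup.center P).map (P : Subgroup G).subtype with hZ
  have hZn : Z.Normal := inferInstance
  have hZbot : Z ≠ ⊥ := by
    rw [hZ, Ne, (Subgroup.map_eq_bot_iff_of_injective _ (Subgroup.subtype_injective _))]
    exact (Subgroup.nontrivial_iff_ne_bot _).1 P.2.center_nontrivial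
  have hNZ : N ≤ Z := inf_eq_left.1 <| (hmin (N ⊓ Z) inferInstance inf_le_left).resolve_left
    (hinf N Z hNn hZn hN hZbot)
  have hPC : (P : Subgroup G) ≤ Subgroup.centralizer (N : Set G) := by
    intro x hx
    rw [Subgroup.mem_centralizer_iff]
    intro y hy
    obtain ⟨z, hz, rfl⟩ := hNZ hy
    exact (congrArg Subtype.val (Subgroup.mem_center_iff.1 hz ⟨x, hx⟩)).symm
  have htop : Subgroup.centralizer (N : Set G) = ⊤ := by
    rw [← Subgroup.index_eq_one]
    refine Nat.eq_one_iff_not_exists_prime_dvd.2 fun r hr hrd => ?_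
    have : Fact r.Prime := ⟨hr⟩
    by_cases hrp : r = p
    · subst hrp
      exact P.not_dvd_index (hrd.trans (Subgroup.index_dvd_of_le hPC))
    · let T : Sylow r G := default
      exact T.not_dvd_index (hrd.trans (Subgroup.index_dvd_of_le (hc r hr hrp T)))
  obtain ⟨H, hHN, hH⟩ := Subgroup.exists_le_card_prime hN
  refine hprime H ⟨fun x hx g => ?_⟩ hH
  have := Subgroup.mem_centralizer_iff.1 (htop ▸ Subgroup.mem_top g) x (hHN hx)
  rwa [← this, mul_inv_cancel_right]

theorem Subgroup.covBy_sup_normalizer_sylow [Finite G] {N : Subgroup G} (hNn : N.Normal)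
    (hN : N ≠ ⊥) (hmin : ∀ M : Subgroup G, M.Normal → M ≤ N → M = ⊥ ∨ M = N)
    (hNC : _root_.commutator G ≤ Subgroup.centralizer (N : Set G)) {p r : ℕ} [Fact p.Prime]
    [Fact r.Prime] (hNp : IsPGroup p N) (hrp : r ≠ p) (T : Sylow r G)
    (hT : ¬ (T : Subgroup G) ≤ Subgroup.centralizer (N : Set G))
    (htop : Subgroup.normalizer ((T : Subgroup G) : Set G) ⊔ _root_.commutator G = ⊤) :
    Subgroup.normalizer ((T : Subgroup G) : Set G) ⊓ N = ⊥ ∧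
      Subgroup.normalizer ((T : Subgroup G) : Set G) ⋖
        Subgroup.normalizer ((T : Subgroup G) : Set G) ⊔ N := by
  set A := Subgroup.normalizer ((T : Subgroup G) : Set G)
  have key : ∀ C : Subgroup G, A ≤ C → C ⊓ N = ⊥ ∨ C ⊓ N = N := by
    intro C hAC
    refine hmin _ (Subgroup.normalizer_eq_top_iff.1 (top_le_iff.1 ?_)) inf_le_right
    rw [← htop]
    refine sup_le (fun a ha => ?_) ?_
    · rw [Subgroup.mem_normalizer_iff]
      intro x
      have h1 : x ∈ C ↔ a * x * a⁻¹ ∈ C := by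
        rw [Subgroup.mul_mem_cancel_right C (C.inv_mem (hAC ha)),
          Subgroup.mul_mem_cancel_left C (hAC ha)]
      exact and_congr h1 ⟨fun hx => hNn.conj_mem x hx a, fun hx => by
        simpa [mul_assoc] using hNn.conj_mem _ hx a⁻¹⟩
    · exact hNC.trans ((Subgroup.centralizer_le inf_le_right).trans
        (Subgroup.centralizer_le_normalizer _))
  have hdisj : N ⊓ T = ⊥ :=
    (IsPGroup.disjoint_of_ne p r hrp.symm N T hNp T.2).eq_bot
  have hAN : A ⊓ N = ⊥ := by
    refine (key A le_rfl).resolve_right fun h => hT fun t ht => ?_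
    rw [Subgroup.mem_centralizer_iff]
    intro n hn
    have hnA : n ∈ A := inf_eq_right.1 h hn
    have h1 : n * t * n⁻¹ * t⁻¹ ∈ N ⊓ T := by
      refine ⟨?_, (T : Subgroup G).mul_mem ((Subgroup.mem_normalizer_iff.1 hnA t).1 ht)
      (inv_mem ht)⟩
      rw [mul_assoc, mul_assoc, ← mul_assoc t]
      exact N.mul_mem hn (hNn.conj_mem _ (N.inv_mem hn) t)
    rw [hdisj, Subgroup.mem_bot, mul_inv_eq_one, mul_inv_eq_iff_eq_mul] at h1
    exact h1
  refine ⟨hAN, lt_of_le_of_ne le_sup_left fun he => hN ?_, fun C hAC hCA => ?_⟩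
  · rw [← hAN, eq_comm, inf_eq_right, he]
    exact le_sup_right
  · have hC := Subgroup.sup_inf_eq_of_le_sup hAC.le hCA.le
    rcases key C hAC.le with h | h
    · rw [h, sup_bot_eq] at hC
      exact hAC.ne hC
    · rw [h] at hC
      exact hCA.ne hC.symm

theorem Sylow.normalizer_sup_commutator [Finite G] {r : ℕ} [Fact r.Prime] (T : Sylow r G) :
    Subgroup.normalizer ((T : Subgroup G) : Set G) ⊔ commutator G = ⊤ := by
  have hn : ((T : Subgroup G) ⊔ commutator G).Normal :=
    Subgroup.Normal.of_commutator_le G le_sup_right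
  have : Subgroup.normalizer ((T : Subgroup G) : Set G) ⊔ ((T : Subgroup G) ⊔ commutator G) = ⊤ :=
    Sylow.normalizer_sup_eq_top' T le_sup_left
  rwa [← sup_assoc, sup_eq_left.2 (Subgroup.le_normalizer (H := (T : Subgroup G)))] at this

/-- The core of the argument, for groups in which nontrivial normal subgroups always meet. -/
theorem le_commutator_of_isPGroup [Finite G] [Group.IsSolvable G]
    (hE : ∀ H : Subgroup G, (Nat.card H).Prime → EqualChains H)
    (hinf : ∀ N R : Subgroup G, N.Normal → R.Normal → N ≠ ⊥ → R ≠ ⊥ → N ⊓ R ≠ ⊥)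
    (hprime : ∀ X : Subgroup G, X.Normal → ¬ (Nat.card X).Prime)
    {F : Subgroup G} (hFn : F.Normal) (hGF : commutator G ≤ F) {p : ℕ} [Fact p.Prime]
    (hF : IsPGroup p F) (hz : Subgroup.center (commutator G) ≠ ⊥) : F ≤ commutator G := by
  have hp : p.Prime := Fact.out
  have hPn : ∀ P : Sylow p G, (P : Subgroup G).Normal := fun P =>
    Subgroup.Normal.of_commutator_le G (hGF.trans (hF.le_sylow_of_normal P))
  have hcov : ∀ X : Subgroup G, Nat.card X = p → PrimeCovers X := by
    intro X hX
    obtain ⟨P, hP⟩ := (IsPGroup.of_card (n := 1) (by rw [hX, pow_one])).exists_primeChain_sylow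
    have := hPn P
    exact (hE X (hX ▸ hp)).primeCovers
      (Relation.ReflTransGen.trans hP (PrimeChain.le_top_of_normal (P : Subgroup G)))
  set Z := (Subgroup.center (commutator G)).map (commutator G).subtype with hZ
  have hZn : Z.Normal := inferInstance
  have hZbot : Z ≠ ⊥ := by
    rwa [hZ, Ne, (Subgroup.map_eq_bot_iff_of_injective _ (Subgroup.subtype_injective _))]
  obtain ⟨N, ⟨hNn, hN⟩, hNmin⟩ := WellFounded.has_min (wellFounded_lt (α := Subgroup G))
    {N | N.Normal ∧ N ≠ ⊥} ⟨Z, hZn, hZbot⟩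
  have hmin : ∀ M : Subgroup G, M.Normal → M ≤ N → M = ⊥ ∨ M = N := fun M hM hMN =>
    or_iff_not_imp_left.2 fun hb => hMN.eq_of_not_lt (hNmin M ⟨hM, hb⟩)
  have hNZ : N ≤ Z := inf_eq_left.1 <| (hmin (N ⊓ Z) inferInstance inf_le_left).resolve_left
    (hinf N Z hNn hZn hN hZbot)
  have hNF : N ≤ F := hNZ.trans ((Subgroup.map_subtype_le _).trans hGF)
  have hNC : commutator G ≤ Subgroup.centralizer (N : Set G) := by
    intro x hx
    rw [Subgroup.mem_centralizer_iff]
    intro y hy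
    obtain ⟨z, hz, rfl⟩ := hNZ hy
    exact (congrArg Subtype.val (Subgroup.mem_center_iff.1 hz ⟨x, hx⟩)).symm
  let P : Sylow p G := default
  obtain ⟨r, hr, hrp, T, hT⟩ := Subgroup.exists_sylow_not_le_centralizer hinf hprime (hPn P) hNn
    hN hmin (hNF.trans (hF.le_sylow_of_normal P))
  have : Fact r.Prime := ⟨hr⟩
  have htop := T.normalizer_sup_commutator
  obtain ⟨hAN, hcovBy⟩ := Subgroup.covBy_sup_normalizer_sylow hNn hN hmin hNC (hF.to_le hNF) hrp T
    hT htop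
  set A := Subgroup.normalizer ((T : Subgroup G) : Set G)
  have hpA : ¬ p ∣ Nat.card A := by
    intro hd
    obtain ⟨X, hXA, hX⟩ := Subgroup.exists_le_card_eq_prime hp hd
    have := hcov X hX A _ hXA hcovBy
    rw [Subgroup.relIndex_sup_of_inf_eq_bot hAN] at this
    exact hprime N hNn this
  have hidx : (commutator G).index ∣ Nat.card A := by
    rw [← Subgroup.relIndex_top_right, ← htop, Subgroup.relIndex_sup_right]
    exact Subgroup.relIndex_dvd_card _ _
  obtain ⟨k, hk⟩ := IsPGroup.iff_card.1 hF
  rw [← Subgroup.relIndex_eq_one]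
  refine Nat.eq_one_of_dvd_coprimes (((hp.coprime_iff_not_dvd.2 hpA)).pow_left k)
    (hk ▸ Subgroup.relIndex_dvd_card _ _) ?_
  exact (Subgroup.relIndex_dvd_index_of_normal _ _).trans hidx

end Main

theorem stmt_9 {G : Type*} [Group G] [Finite G]
    (hchains : ∀ H : Subgroup G, (Nat.card H).Prime → AllMaxChainsSameLength H)
    (F : Subgroup G) (hFnormal : F.Normal) (hFnilpotent : Group.IsNilpotent F)
    (hFmax : ∀ N : Subgroup G, N.Normal → Group.IsNilpotent N → N ≤ F)
    (hns : ¬ IsSupersolvable G)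
    (hz : Subgroup.center (commutator G) ≠ ⊥) :
    F = commutator G := by

  have hE : ∀ H : Subgroup G, (Nat.card H).Prime → EqualChains H := by
    intro H hH r s hr hs
    obtain ⟨c, hc⟩ := hr.exists_seq
    obtain ⟨d, hd⟩ := hs.exists_seq
    exact hchains H hH r s c d hc hd
  set Z := (Subgroup.center (commutator G)).map (commutator G).subtype with hZ
  have hZn : Z.Normal := inferInstance
  have hZbot : Z ≠ ⊥ := by
    rwa [hZ, Ne, (Subgroup.map_eq_bot_iff_of_injective _ (Subgroup.subtype_injective _))]
  have hZC : Z ≤ Subgroup.centralizer (commutator G) := by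
    rintro _ ⟨z, hz, rfl⟩
    rw [Subgroup.mem_centralizer_iff]
    exact fun x hx => congrArg Subtype.val (Subgroup.mem_center_iff.1 hz ⟨x, hx⟩)
  have hZs : Group.IsSolvable Z := by
    have hcomm : ∀ a b : Z, a * b = b * a := fun a b =>
      Subtype.ext (Subgroup.mem_centralizer_iff.1 (hZC b.2) a (Subgroup.map_subtype_le _ a.2))
    exact Group.isSolvable_of_comm hcomm
  have hsolv : Group.IsSolvable G := EqualChains.isSolvable_of_normal hE hZs hZbot
  have hcov : ∀ R : Subgroup G, R.Normal → R ≠ ⊥ → PrimeCovers R := fun R _ hbot =>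
    .of_normal hE hbot
  have hprime : ∀ X : Subgroup G, X.Normal → ¬ (Nat.card X).Prime := fun X hXn hX =>
    hns ((hcov X hXn (Subgroup.ne_bot_of_card_prime hX)).isSupersolvable_of_card_prime hX)
  have hinf : ∀ N R : Subgroup G, N.Normal → R.Normal → N ≠ ⊥ → R ≠ ⊥ → N ⊓ R ≠ ⊥ := by
    intro N R hNn hRn hN hR h
    obtain ⟨X, -, hXn, hX⟩ :=
      (hcov R hRn hR).exists_normal_card_prime_le hRn (by rwa [inf_comm]) hN
    exact hprime X hXn hX
  have hGF : commutator G ≤ F := hFmax _ inferInstance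
    (isNilpotent_commutator_of_quotient hZC (hcov Z hZn hZbot).quotient.isNilpotent_commutator)
  have hF : F ≠ ⊥ := fun h =>
    hZbot (le_bot_iff.1 (h ▸ (Subgroup.map_subtype_le _).trans hGF))
  obtain ⟨p, hp, hFp⟩ := exists_isPGroup_of_forall_normal_inf_ne_bot hinf F hF
  have : Fact p.Prime := ⟨hp⟩
  exact le_antisymm (le_commutator_of_isPGroup hE hinf hprime hFnormal hGF hFp hz) hGF
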